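/- Let n ≥ 7 be an integer with n ≡ 1 (mod 6), let λ ≥ 1 be a real number, and let p : ZMod n → ℂ satisfy 1 ≤ ‖p j‖ ≤ λ and 1 ≤ ‖p j - p (j-1)‖ ≤ λ for every j ∈ ZMod n. Then λ ≥ 2·sin((π/6)·(n/(n-1))). -/

import Mathlib

open Real

/-- If a triangle with sides `2 sin A` and `2 sin B` has its third side at least `1`, then the
angle opposite to that side is at least `2π/3 - A - B`. -/
lemma two_pi_div_three_sub_le_angle {A B θ : ℝ} (hA : π / 6 ≤ A)
    (hB : π / 6 ≤ B) (hθ : 0 ≤ θ)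
    (h : 1 ≤ (2 * sin A) ^ 2 + (2 * sin B) ^ 2 - 2 * (2 * sin A) * (2 * sin B) * cos θ) :
    2 * π / 3 - A - B ≤ θ := by
  have hpi := pi_pos
  by_contra! hlt
  have hsA : 0 < sin A := sin_pos_of_pos_of_lt_pi (by linarith) (by linarith)
  have hsB : 0 < sin B := sin_pos_of_pos_of_lt_pi (by linarith) (by linarith)
  have hcos : cos (2 * π / 3 - A - B) < cos θ :=
    cos_lt_cos_of_nonneg_of_le_pi hθ (by linarith) hlt
  have hmul := mul_lt_mul_of_pos_left hcos (mul_pos hsA hsB)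
  have hd : cos (A + B - π / 3) ≤ cos (A - B) := by
    rw [← cos_abs (A - B)]
    exact cos_le_cos_of_nonneg_of_le_pi (abs_nonneg _) (by linarith)
      (abs_le.2 ⟨by linarith, by linarith⟩)
  have hτ : 0 ≤ cos (A + B - π / 3) :=
    cos_nonneg_of_neg_pi_div_two_le_of_le (by linarith) (by linarith)
  have key : 8 * (sin A * sin B) * cos (2 * π / 3 - A - B)
      - (4 * sin A ^ 2 + 4 * sin B ^ 2 - 1)
      = 4 * cos (A + B - π / 3) * (cos (A - B) - cos (A + B - π / 3)) := by
    have e : 2 * π / 3 - A - B = π / 3 - (A + B - π / 3) := by ring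
    have h3 : √3 ^ 2 = 3 := sq_sqrt (by norm_num)
    rw [e, cos_sub (π / 3), cos_sub (A + B), sin_sub (A + B), cos_pi_div_three,
      sin_pi_div_three, cos_add, sin_add, cos_sub]
    have hA2 : cos A ^ 2 = 1 - sin A ^ 2 := cos_sq' A
    have hB2 : cos B ^ 2 = 1 - sin B ^ 2 := cos_sq' B
    grind
  nlinarith [mul_nonneg hτ (sub_nonneg.2 hd)]

/-- If a triangle with sides `2 sin A` and `2 sin B` has its third side at most `2 sin L`, then
the angle opposite to that side is at most `2L + π/3 - A - B`. -/
lemma angle_le_two_mul_add_pi_div_three {A B L θ : ℝ} (hA : π / 6 ≤ A) (hAL : A ≤ L)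
    (hB : π / 6 ≤ B) (hBL : B ≤ L) (hL : L ≤ π / 4) (hθ : θ ≤ π)
    (h : (2 * sin A) ^ 2 + (2 * sin B) ^ 2 - 2 * (2 * sin A) * (2 * sin B) * cos θ
      ≤ (2 * sin L) ^ 2) :
    θ ≤ 2 * L + π / 3 - A - B := by
  have hpi := pi_pos
  have hsL : 0 < sin L := sin_pos_of_pos_of_lt_pi (by linarith) (by linarith)
  have aux : ∀ {C : ℝ}, π / 6 ≤ C → C ≤ L →
      ∃ x, 0 ≤ x ∧ x ≤ L + π / 6 - C ∧ 2 * sin C * sin x = sin L ∧ 0 < sin C := by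
    intro C hC hCL
    have hsC : 0 < sin C := sin_pos_of_pos_of_lt_pi (by linarith) (by linarith)
    have hle : sin L ≤ 2 * sin C * sin (L + π / 6 - C) := by
      have h1 : 2 * sin C * sin (L + π / 6 - C)
          = cos (2 * C - L - π / 6) - cos (L + π / 6) := by
        rw [two_mul_sin_mul_sin]; ring_nf
      have h2 : sin L = cos (L - π / 6) - cos (L + π / 6) := by
        rw [cos_sub, cos_add, sin_pi_div_six]; ring
      have h3 : cos (L - π / 6) ≤ cos (2 * C - L - π / 6) := by
        rw [← cos_abs (2 * C - L - π / 6)]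
        exact cos_le_cos_of_nonneg_of_le_pi (abs_nonneg _) (by linarith)
          (abs_le.2 ⟨by linarith, by linarith⟩)
      linarith
    have hdiv : sin L / (2 * sin C) ≤ sin (L + π / 6 - C) := by
      rw [div_le_iff₀ (by positivity)]; linarith
    have hpos : 0 ≤ sin L / (2 * sin C) := by positivity
    refine ⟨arcsin (sin L / (2 * sin C)), arcsin_nonneg.2 hpos, ?_, ?_, hsC⟩
    · exact (arcsin_le_iff_le_sin' ⟨by linarith, by linarith⟩).2 hdiv
    · rw [sin_arcsin (by linarith) (hdiv.trans (sin_le_one _))]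
      field_simp
  obtain ⟨x, hx0, hx, hxs, hsA⟩ := aux hA hAL
  obtain ⟨y, hy0, hy, hys, hsB⟩ := aux hB hBL
  suffices θ ≤ x + y by linarith
  by_contra! hlt
  have hcos : cos θ < cos (x + y) := cos_lt_cos_of_nonneg_of_le_pi (by linarith) hθ hlt
  have hsx : 0 < sin x := by
    by_contra! hx'
    nlinarith
  have hsy : 0 < sin y := by
    by_contra! hy'
    nlinarith
  have h1 : sin A ^ 2 + sin B ^ 2 - 2 * sin A * sin B * cos (x + y) < sin L ^ 2 := by
    nlinarith [mul_lt_mul_of_pos_left hcos (mul_pos hsA hsB)]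
  have h2 := mul_lt_mul_of_pos_left h1 (show 0 < 4 * sin x ^ 2 * sin y ^ 2 by positivity)
  have h3 : sin L ^ 2 * (sin x ^ 2 + sin y ^ 2 - 2 * sin x * sin y * cos (x + y))
      < sin L ^ 2 * (4 * sin x ^ 2 * sin y ^ 2) := by
    calc _ = 4 * sin x ^ 2 * sin y ^ 2 *
          (sin A ^ 2 + sin B ^ 2 - 2 * sin A * sin B * cos (x + y)) := by
          have e1 : sin L ^ 2 * sin x ^ 2 = 4 * sin B ^ 2 * sin y ^ 2 * sin x ^ 2 := by
            rw [← hys]; ring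
          have e2 : sin L ^ 2 * sin y ^ 2 = 4 * sin A ^ 2 * sin x ^ 2 * sin y ^ 2 := by
            rw [← hxs]; ring
          have e3 : sin L ^ 2 = (2 * sin A * sin x) * (2 * sin B * sin y) := by
            rw [hxs, hys]; ring
          linear_combination e1 + e2 - 2 * sin x * sin y * cos (x + y) * e3
      _ < _ := by linarith
  have h4 := lt_of_mul_lt_mul_left h3 (by positivity)
  rw [cos_add] at h4
  have h5 : cos x * cos y + sin x * sin y ≤ 1 := by
    rw [← cos_sub]; exact cos_le_one _
  nlinarith [mul_le_mul_of_nonneg_left h5 (mul_pos hsx hsy).le, sq_nonneg (sin x - sin y)]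

lemma sin_pi_div_six_mul_mul_sin_pi_div_six_div_le {r : ℝ} (h1 : 1 ≤ r) (h2 : r ≤ 7 / 6) :
    sin (π / 6 * r) * sin (π / 6 / r) ≤ 1 / 4 := by
  have hpi := pi_gt_d2
  have hpi' := pi_lt_d2
  have hr : 0 < r := by linarith
  set u := π / 6 * (r - 1 / r) with hu
  set w := π / 6 * ((r - 1) ^ 2 / r) with hw
  have hprod : 2 * sin (π / 6 * r) * sin (π / 6 / r) = cos u - cos (π / 3 + w) := by
    rw [two_mul_sin_mul_sin, hu, hw]
    congr 2
    · ring
    · field_simp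
      ring
  have hw0 : 0 ≤ w := by positivity
  have hu0 : 0 ≤ u := by
    have : 1 / r ≤ 1 := by rw [div_le_one hr]; exact h1
    have : 0 ≤ r - 1 / r := by linarith
    positivity
  have hrinv : 6 / 7 ≤ 1 / r := by rw [le_div_iff₀ hr]; linarith
  have hu1 : u ≤ 1 / 5 := by
    have : r - 1 / r ≤ 13 / 42 := by linarith
    nlinarith
  have hw1 : w ≤ 1 / 50 := by
    have : (r - 1) ^ 2 / r ≤ 1 / 36 := by rw [div_le_iff₀ hr]; nlinarith
    nlinarith
  have huw : 2.09 * w ≤ u ^ 2 := by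
    have e : u ^ 2 = w * (π / 6 * ((r + 1) ^ 2 / r)) := by
      rw [hu, hw]; field_simp; ring
    have : 4 ≤ (r + 1) ^ 2 / r := by
      rw [le_div_iff₀ hr]; nlinarith [sq_nonneg (r - 1)]
    rw [e, mul_comm]
    apply mul_le_mul_of_nonneg_left _ hw0
    nlinarith
  have hcu : cos u ≤ 1 - u ^ 2 / 2 + u ^ 4 * (5 / 96) := by
    have := abs_le.1 (cos_bound (x := u) (by rw [abs_of_nonneg hu0]; linarith))
    rw [abs_of_nonneg hu0] at this
    linarith [this.2]
  have hcw : 1 / 2 - w ^ 2 / 4 - 0.8661 * w ≤ cos (π / 3 + w) := by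
    rw [cos_add, cos_pi_div_three, sin_pi_div_three]
    have a1 := one_sub_sq_div_two_le_cos (x := w)
    have a2 := sin_le hw0
    have a3 : √3 ≤ 1.7322 := by
      rw [sqrt_le_left (by norm_num)]; norm_num
    have a4 : √3 * sin w ≤ 1.7322 * w :=
      (mul_le_mul_of_nonneg_left a2 (sqrt_nonneg _)).trans
        (mul_le_mul_of_nonneg_right a3 hw0)
    linarith
  have hu4 : u ^ 4 ≤ u ^ 2 / 25 := by
    have : u ^ 2 ≤ 1 / 25 := by nlinarith
    nlinarith [sq_nonneg u]
  have hw2 : w ^ 2 ≤ w / 50 := by nlinarith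
  linarith

/-- In a triangle with all sides in `[1, l]`, where `l (l - 1) ≤ 1`, every angle is at least the
apex angle of the isosceles triangle with legs `l` and base `1`. -/
lemma cos_angle_le_of_sides_mem_Icc {a b l t : ℝ} (ha : 1 ≤ a) (hb : 1 ≤ b) (hal : a ≤ l)
    (hbl : b ≤ l) (hl : l * (l - 1) ≤ 1) (h : 1 ≤ a ^ 2 + b ^ 2 - 2 * a * b * t) :
    t ≤ 1 - 1 / (2 * l ^ 2) := by
  have hl0 : 0 < l := by linarith
  have key : (a - b) ^ 2 * l ^ 2 + a * b ≤ l ^ 2 := by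
    wlog hab : a ≤ b generalizing a b
    · have := this hb ha hbl hal (by linarith) (by linarith)
      linarith
    have h1 : (a - b) ^ 2 ≤ (l - a) ^ 2 := by nlinarith
    have h2 : l * (l - a) ≤ 1 := by nlinarith
    nlinarith [mul_le_mul_of_nonneg_left h1 (sq_nonneg l),
      mul_le_mul_of_nonneg_left h2 (mul_nonneg hl0.le (sub_nonneg.2 hal))]
  have e : 1 - 1 / (2 * l ^ 2) = (2 * l ^ 2 - 1) / (2 * l ^ 2) := by field_simp
  rw [e, le_div_iff₀ (by positivity)]
  have hab : 0 < a * b := by positivity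
  by_contra! hlt
  nlinarith [mul_lt_mul_of_pos_left hlt hab, mul_le_mul_of_nonneg_right h (sq_nonneg l)]

/-- Signed sums of a function on `ZMod n` controlled edgewise by a vertex potential `h`. -/
lemma sum_ite_neg_le_of_potential {n : ℕ} [NeZero n] {y h : ZMod n → ℝ} {δ : ℝ}
    (hy₁ : ∀ j, -y j ≤ h j + h (j - 1)) (hy₂ : ∀ j, y j ≤ δ - h j - h (j - 1))
    (h₀ : ∀ j, 0 ≤ h j) (hδ : ∀ j, 2 * h j ≤ δ) {N : Finset (ZMod n)} (hN : N.Nonempty)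
    (hN' : N ≠ Finset.univ) :
    ∑ j, (if j ∈ N then -y j else y j) ≤ (n - 1) * δ := by
  obtain ⟨i, hi, hi'⟩ : ∃ i, i ∈ N ∧ i + 1 ∉ N := by
    by_contra! hcl
    obtain ⟨a, ha⟩ := hN
    have hall : ∀ k : ℕ, a + k ∈ N := by
      intro k
      induction k with
      | zero => simpa using ha
      | succ k ih => simpa [add_assoc] using hcl _ ih
    apply hN'
    ext b
    have := hall (b - a).val
    rw [ZMod.natCast_zmod_val, add_sub_cancel] at this
    simp [this]
  have hδ₀ : 0 ≤ δ := by linarith [h₀ 0, hδ 0]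
  calc ∑ j, (if j ∈ N then -y j else y j)
      ≤ ∑ j, ((if j ∈ N then h j else δ - h j) + if j ∈ N then h (j - 1) else -h (j - 1)) := by
        apply Finset.sum_le_sum
        intro j _
        split_ifs
        · exact hy₁ j
        · linarith [hy₂ j]
    _ = ∑ j, ((if j ∈ N then h j else δ - h j) + if j + 1 ∈ N then h j else -h j) := by
        rw [Finset.sum_add_distrib, Finset.sum_add_distrib]
        congr 1
        rw [← Equiv.sum_comp (Equiv.addRight (1 : ZMod n))]
        simp
    _ ≤ ∑ j, (δ - if j = i then δ else 0) := by
        apply Finset.sum_le_sum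
        intro j _
        have := h₀ j
        have := hδ j
        by_cases hji : j = i
        · subst hji
          simp [hi, hi']
        · split_ifs <;> linarith
    _ = (n - 1) * δ := by
        simp [Finset.sum_sub_distrib, ZMod.card]
        ring

/-- The arguments of the successive quotients of a closed nowhere-zero sequence add up to a
multiple of `2π`. -/
lemma exists_sum_arg_div_eq {n : ℕ} [NeZero n] {p : ZMod n → ℂ} (hp : ∀ j, p j ≠ 0) :
    ∃ k : ℤ, ∑ j, (p j / p (j - 1)).arg = 2 * π * k := by
  have h : ((∑ j, (p j / p (j - 1)).arg : ℝ) : Real.Angle) = ((0 : ℝ) : Real.Angle) := by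
    have hsum : ((∑ j, (p j / p (j - 1)).arg : ℝ) : Real.Angle)
        = ∑ j, ((p j / p (j - 1)).arg : Real.Angle) :=
      map_sum Real.Angle.coeHom _ _
    rw [hsum]
    simp_rw [fun j => Complex.arg_div_coe_angle (hp j) (hp (j - 1))]
    have hshift := Equiv.sum_comp (Equiv.subRight (1 : ZMod n))
      fun j => ((p j).arg : Real.Angle)
    simp only [Equiv.subRight_apply] at hshift
    rw [Finset.sum_sub_distrib, hshift]
    simp
  obtain ⟨k, hk⟩ := Real.Angle.angle_eq_iff_two_pi_dvd_sub.1 h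
  exact ⟨k, by simpa using hk⟩

/-- If `θ` is an assignment of signed angles to a cycle of length `n ≡ 1 mod 6` whose moduli are
controlled by a potential, then the sum of the `θ j` is not a multiple of `2π`. -/
lemma sum_ne_two_pi_mul_of_potential {n : ℕ} [NeZero n] (hmod : n % 6 = 1)
    {θ h : ZMod n → ℝ} {δ : ℝ}
    (hθ₁ : ∀ j, π / 3 - |θ j| ≤ h j + h (j - 1))
    (hθ₂ : ∀ j, |θ j| - π / 3 ≤ δ - h j - h (j - 1))
    (h₀ : ∀ j, 0 ≤ h j) (hδ : ∀ j, 2 * h j ≤ δ) (hδn : (n - 1) * δ < π / 3)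
    (hδ' : δ < π / 3) (hθ₃ : ∀ j, π / 3 - |θ j| < π / 3 / n) (k : ℤ) :
    ∑ j, θ j ≠ 2 * π * k := by
  intro hk
  have hpi := pi_pos
  have hn : (0 : ℝ) < n := by exact_mod_cast NeZero.pos n
  set y : ZMod n → ℝ := fun j => |θ j| - π / 3 with hy
  set D : Finset (ZMod n) → ℝ := fun N => ∑ j, if j ∈ N then -y j else y j with hD
  have D_compl : ∀ N, D Nᶜ = -D N := by
    intro N
    simp only [hD, ← Finset.sum_neg_distrib]
    refine Finset.sum_congr rfl fun j _ => ?_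
    by_cases hj : j ∈ N <;> simp [hj]
  have D_mid : ∀ N : Finset (ZMod n), N.Nonempty → N ≠ Finset.univ → D N < π / 3 :=
    fun N hN hN' => (sum_ite_neg_le_of_potential (fun j => by simpa [hy] using hθ₁ j)
      (fun j => hθ₂ j) h₀ hδ hN hN').trans_lt hδn
  have D_univ : D Finset.univ < π / 3 := by
    calc D Finset.univ < ∑ _j : ZMod n, π / 3 / n := by
          simp only [hD, Finset.mem_univ, if_true]
          exact Finset.sum_lt_sum_of_nonempty ⟨0, Finset.mem_univ _⟩
            fun j _ => by simpa [hy] using hθ₃ j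
      _ = π / 3 := by
          simp [ZMod.card]
          field_simp
  have D_empty : D ∅ < 2 * (π / 3) := by
    calc D ∅ ≤ ∑ _j : ZMod n, δ := by
          simp only [hD, Finset.notMem_empty, if_false]
          exact Finset.sum_le_sum fun j _ =>
            (hθ₂ j).trans (by linarith [h₀ j, h₀ (j - 1)])
      _ = (n - 1) * δ + δ := by
          simp [ZMod.card]
          ring
      _ < _ := by linarith
  set N : Finset (ZMod n) := {j | θ j < 0} with hN
  have hDN : D N = (6 * k - (n - 2 * N.card) : ℤ) * (π / 3) := by
    have e : ∀ j, (if j ∈ N then -y j else y j)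
        = θ j - π / 3 + if j ∈ N then 2 * (π / 3) else 0 := by
      intro j
      by_cases hj : θ j < 0
      · simp [hN, hy, hj, abs_of_neg hj]
        ring
      · simp [hN, hy, hj, abs_of_nonneg (not_lt.1 hj)]
    simp only [hD]
    rw [Finset.sum_congr rfl fun j _ => e j, Finset.sum_add_distrib, Finset.sum_sub_distrib, hk]
    simp [ZMod.card]
    ring
  have lt_of : ∀ a b : ℤ, (a : ℝ) * (π / 3) < b * (π / 3) → a < b := fun a b hab => by
    exact_mod_cast lt_of_mul_lt_mul_right hab (by positivity)
  rcases N.eq_empty_or_nonempty with h0 | hne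
  · have h1 := lt_of (6 * k - (n - 2 * N.card)) 2 (by rw [← hDN, h0]; exact_mod_cast D_empty)
    have h2 := lt_of (-1) (6 * k - (n - 2 * N.card)) (by
      have := D_compl ∅
      rw [Finset.compl_empty] at this
      rw [← hDN, h0]
      push_cast
      linarith)
    rw [h0, Finset.card_empty] at h1 h2
    omega
  by_cases hu : N = Finset.univ
  · have h1 := lt_of (6 * k - (n - 2 * N.card)) 1 (by
      rw [← hDN, hu]; push_cast; linarith)
    have h2 := lt_of (-2) (6 * k - (n - 2 * N.card)) (by
      have := D_compl Finset.univ
      rw [Finset.compl_univ] at this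
      rw [← hDN, hu]
      push_cast
      linarith)
    rw [hu, Finset.card_univ, ZMod.card] at h1 h2
    omega
  · have h1 := lt_of (6 * k - (n - 2 * N.card)) 1 (by
      rw [← hDN]; push_cast; linarith [D_mid N hne hu])
    have h2 := lt_of (-1) (6 * k - (n - 2 * N.card)) (by
      have := D_mid Nᶜ (by rwa [Finset.nonempty_iff_ne_empty, Ne, Finset.compl_eq_empty_iff])
        (by rw [Ne, Finset.compl_eq_univ_iff]; exact hne.ne_empty)
      rw [D_compl] at this
      rw [← hDN]
      push_cast
      linarith)
    omega

theorem wheel_mod_one_lower_bound (n : ℕ) (hn : 7 ≤ n) (hmod : n % 6 = 1)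
    (l : ℝ) (hl : 1 ≤ l) (p : ZMod n → ℂ)
    (hp : ∀ j : ZMod n,
      1 ≤ ‖p j‖ ∧ ‖p j‖ ≤ l ∧ 1 ≤ ‖p j - p (j - 1)‖ ∧ ‖p j - p (j - 1)‖ ≤ l) :
    2 * Real.sin (Real.pi / 6 * ((n : ℝ) / ((n : ℝ) - 1))) ≤ l := by
  by_contra! hlt
  have : NeZero n := ⟨by omega⟩
  have hpi := pi_pos
  have hn7 : (7 : ℝ) ≤ n := by exact_mod_cast hn
  have hn1 : (0 : ℝ) < n - 1 := by linarith
  set r : ℝ := n / (n - 1) with hr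
  have hr1 : 1 ≤ r := by rw [hr, le_div_iff₀ hn1]; linarith
  have hr2 : r ≤ 7 / 6 := by rw [hr, div_le_iff₀ hn1]; linarith
  have hr0 : 0 < r := by linarith
  have hrn : (n - 1) * r = n := by rw [hr]; field_simp
  have hrπ : π / 6 * r ≤ π / 4 := by nlinarith
  have hsin_mono : ∀ {x y : ℝ}, 0 ≤ x → x ≤ y → y ≤ π / 2 → sin x ≤ sin y := fun hx hxy hy =>
    sin_le_sin_of_le_of_le_pi_div_two (by linarith) hy hxy
  have hl2 : l ^ 2 ≤ 2 := by
    have h1 := hsin_mono (by positivity) hrπ (by linarith)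
    rw [sin_pi_div_four] at h1
    have h2 : √2 ^ 2 = 2 := sq_sqrt (by norm_num)
    have h3 : l ≤ √2 := by linarith
    nlinarith
  have hl_lt : l < 2 := by nlinarith
  set L := arcsin (l / 2) with hL
  have sin_arcsin_half : ∀ {a : ℝ}, 1 ≤ a → a ≤ l → 2 * sin (arcsin (a / 2)) = a := by
    intro a ha hal
    rw [sin_arcsin (by linarith) (by linarith)]
    ring
  have hLr : L < π / 6 * r :=
    (arcsin_lt_iff_lt_sin' ⟨by linarith [mul_pos hpi hr0], by linarith⟩).2 (by linarith)
  have le_arcsin_half : ∀ {a : ℝ}, 1 ≤ a → π / 6 ≤ arcsin (a / 2) := by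
    intro a ha
    rw [le_arcsin_iff_sin_le' ⟨by linarith, by linarith⟩, sin_pi_div_six]
    linarith
  have hp0 : ∀ j, p j ≠ 0 := fun j hj => by
    have := (hp j).1
    rw [hj, norm_zero] at this
    linarith
  have hlaw : ∀ j, ‖p j - p (j - 1)‖ ^ 2 = ‖p j‖ ^ 2 + ‖p (j - 1)‖ ^ 2
      - 2 * ‖p j‖ * ‖p (j - 1)‖ * cos |(p j / p (j - 1)).arg| := by
    intro j
    rw [← Complex.angle_eq_abs_arg (hp0 j) (hp0 _)]
    have := InnerProductGeometry.norm_sub_sq_eq_norm_sq_add_norm_sq_sub_two_mul_norm_mul_norm_mul_cos_angle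
      (p j) (p (j - 1))
    linear_combination this
  have hge : ∀ j, 1 ≤ ‖p j - p (j - 1)‖ ^ 2 := fun j => one_le_pow₀ (hp j).2.2.1
  have hle : ∀ j, ‖p j - p (j - 1)‖ ^ 2 ≤ l ^ 2 := fun j =>
    pow_le_pow_left₀ (norm_nonneg _) (hp j).2.2.2 2
  have hA : ∀ j, π / 6 ≤ arcsin (‖p j‖ / 2) := fun j => le_arcsin_half (hp j).1
  have hAL : ∀ j, arcsin (‖p j‖ / 2) ≤ L := fun j =>
    arcsin_le_arcsin (by linarith [(hp j).2.1])
  have hsA : ∀ j, 2 * sin (arcsin (‖p j‖ / 2)) = ‖p j‖ := fun j =>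
    sin_arcsin_half (hp j).1 (hp j).2.1
  obtain ⟨k, hk⟩ := exists_sum_arg_div_eq hp0
  refine sum_ne_two_pi_mul_of_potential hmod (h := fun j => arcsin (‖p j‖ / 2) - π / 6)
    (δ := 2 * L - π / 3) ?_ ?_ ?_ ?_ ?_ ?_ ?_ k hk
  · intro j
    have := two_pi_div_three_sub_le_angle (hA j) (hA (j - 1))
      (abs_nonneg (p j / p (j - 1)).arg) (by rw [hsA, hsA, ← hlaw]; exact hge j)
    linarith
  · intro j
    have := angle_le_two_mul_add_pi_div_three (hA j) (hAL j) (hA (j - 1)) (hAL (j - 1))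
      (hLr.le.trans hrπ) (Complex.abs_arg_le_pi (p j / p (j - 1)))
      (by rw [hsA, hsA, ← hlaw, sin_arcsin_half hl le_rfl]; exact hle j)
    linarith
  · intro j
    linarith [hA j]
  · intro j
    linarith [hAL j]
  · have := mul_lt_mul_of_pos_left hLr hn1
    have e : (n - 1) * (π / 6 * r) = π / 6 * n := by linear_combination π / 6 * hrn
    linarith
  · linarith
  · intro j
    by_contra! hcon
    have e : π / 3 - π / 3 / n = 2 * (π / 6 / r) := by
      rw [hr]; field_simp; norm_num
    have hφ0 : 0 < π / 6 / r := by positivity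
    have hφ1 : π / 6 / r ≤ π / 6 := div_le_self (by positivity) hr1
    have h1 : cos (2 * (π / 6 / r)) ≤ cos |(p j / p (j - 1)).arg| :=
      cos_le_cos_of_nonneg_of_le_pi (abs_nonneg _) (by linarith) (by linarith)
    have h2 := cos_angle_le_of_sides_mem_Icc (hp j).1 (hp (j - 1)).1 (hp j).2.1
      (hp (j - 1)).2.1 (by nlinarith) ((hge j).trans_eq (hlaw j))
    have hs : 0 < sin (π / 6 / r) := sin_pos_of_pos_of_lt_pi hφ0 (by linarith)
    rw [cos_two_mul, cos_sq'] at h1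
    have h3 : 1 / (2 * l ^ 2) ≤ 2 * sin (π / 6 / r) ^ 2 := by linarith
    rw [div_le_iff₀ (by positivity)] at h3
    have h4 := sin_pi_div_six_mul_mul_sin_pi_div_six_div_le hr1 hr2
    have h5 : 2 * l * sin (π / 6 / r) < 1 := by nlinarith
    have h6 : 0 < 2 * l * sin (π / 6 / r) := by positivity
    nlinarith
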